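/- arXiv:2104.08365 — 2 statements merged into one kernel-verified Lean document; each statement's English description precedes it below -/
import Mathlib

section
/- The Steif distance satisfies the minimax identity d̄(μ,ν) = inf_{m∈M} sup_{e∈E} ∑_s e_s m(d_s) = sup_{e∈E} inf_{m∈M} ∑_s e_s m(d_s) = sup_{e∈E} inf_{m∈M} m(c_e). -/
open MeasureTheory

section Defs
variable {S : Type*} {Xs : S → Type*} [∀ s, MetricSpace (Xs s)]

/-- membership in E: nonnegative, summable weights with total mass at most 1 -/
def inE (e : S → ℝ) : Prop := (∀ s, 0 ≤ e s) ∧ Summable e ∧ ∑' s, e s ≤ 1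

/-- the coordinate semi-metric d_s on the product, as a function on pairs -/
def dd (s : S) (p : (∀ t, Xs t) × (∀ t, Xs t)) : ℝ := dist (p.1 s) (p.2 s)

/-- the cost c_e(x,y) = ∑_s e_s d_s(x_s,y_s) -/
noncomputable def ce (e : S → ℝ) (x y : ∀ s, Xs s) : ℝ := ∑' s, e s * dist (x s) (y s)

/-- the partial Lipschitz constant Δ_s(f) -/
noncomputable def Delta (f : (∀ s, Xs s) → ℝ) (s : S) : ℝ :=
  sSup {r | ∃ x y : ∀ t, Xs t, (∀ t, t ≠ s → x t = y t) ∧ x ≠ y ∧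
    r = (f x - f y) / dist (x s) (y s)}

/-- the Dobrushin semi-norm ‖f‖ = ∑_s Δ_s(f) -/
noncomputable def dobNorm (f : (∀ s, Xs s) → ℝ) : ℝ := ∑' s, Delta f s

variable [∀ s, MeasurableSpace (Xs s)]

/-- m is a coupling (joining) of μ and ν -/
def IsCoupling (μ ν : Measure (∀ s, Xs s)) (m : Measure ((∀ t, Xs t) × (∀ t, Xs t))) : Prop :=
  m.map Prod.fst = μ ∧ m.map Prod.snd = ν

/-- the Dobrushin distance -/
noncomputable def Dob (μ ν : Measure (∀ s, Xs s)) : ℝ :=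
  sSup {r | ∃ f : (∀ s, Xs s) → ℝ, Continuous f ∧ Summable (Delta f) ∧
    (∃ x y, f x ≠ f y) ∧ r = ((∫ x, f x ∂μ) - ∫ x, f x ∂ν) / dobNorm f}

/-- the Steif distance -/
noncomputable def Steif (μ ν : Measure (∀ s, Xs s)) : ℝ :=
  sInf {r | ∃ m : Measure ((∀ t, Xs t) × (∀ t, Xs t)), IsProbabilityMeasure m ∧
    IsCoupling μ ν m ∧ r = ⨆ s, ∫ p, dd s p ∂m}

end Defs

/-- A convex subset of a finite-dimensional coordinate space that avoids the open orthant
`{x | ∀ i, x i < t}` lies in a half-space `t ≤ ∑ i, w i * x i` with `w` in the simplex. -/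
theorem exists_stdSimplex_forall_le_sum {ι : Type*} [Fintype ι] {A : Set (ι → ℝ)}
    (hA : Convex ℝ A) (hne : A.Nonempty) {t : ℝ} (h : ∀ x ∈ A, ∃ i, t ≤ x i) :
    ∃ w ∈ stdSimplex ℝ ι, ∀ x ∈ A, t ≤ ∑ i, w i * x i := by
  classical
  set U : Set (ι → ℝ) := {x | ∀ i, x i < t} with hU
  have hUc : Convex ℝ U := by
    have : U = Set.univ.pi fun _ : ι => Set.Iio t := by ext; simp [hU]
    rw [this]
    exact convex_pi fun _ _ => convex_Iio t
  have hUo : IsOpen U := by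
    have : U = Set.univ.pi fun _ : ι => Set.Iio t := by ext; simp [hU]
    rw [this]
    exact isOpen_set_pi Set.finite_univ fun _ _ => isOpen_Iio
  have hdisj : Disjoint U A := Set.disjoint_left.2 fun x hx hxA => by
    obtain ⟨i, hi⟩ := h x hxA
    exact absurd (hx i) hi.not_gt
  obtain ⟨f, u, hfU, hfA⟩ := geometric_hahn_banach_open hUc hUo hA hdisj
  set c : ι → ℝ := fun i => f (Pi.single i 1) with hc
  have hf : ∀ x, f x = ∑ i, c i * x i := fun x => by
    conv_lhs => rw [← Finset.univ_sum_single x]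
    rw [map_sum]
    refine Finset.sum_congr rfl fun i _ => ?_
    rw [show (Pi.single i (x i) : ι → ℝ) = x i • Pi.single i (1 : ℝ) by
      rw [← Pi.single_smul, smul_eq_mul, mul_one], map_smul, smul_eq_mul, mul_comm]
  have hconst : ∀ b, f (fun _ => b) = (∑ i, c i) * b := fun b => by
    rw [hf, Finset.sum_mul]
  have hc0 : ∀ i, 0 ≤ c i := fun i => by
    by_contra! hi
    obtain ⟨n, hn⟩ := exists_nat_gt ((u - f (fun _ => t - 1)) / (-c i))
    have hmem : (fun _ => t - 1) - (n : ℝ) • (Pi.single i 1 : ι → ℝ) ∈ U := fun j => by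
      have : 0 ≤ (Pi.single i 1 : ι → ℝ) j := by
        by_cases hj : j = i
        · subst hj; simp
        · simp [hj]
      have := mul_nonneg (Nat.cast_nonneg (α := ℝ) n) this
      simp only [Pi.sub_apply, Pi.smul_apply, smul_eq_mul]
      linarith
    have := hfU _ hmem
    rw [map_sub, map_smul, smul_eq_mul] at this
    rw [div_lt_iff₀ (by linarith)] at hn
    change f _ - n * c i < u at this
    linarith
  have htu : (∑ i, c i) * t ≤ u := by
    have hlim : Filter.Tendsto (fun b => (∑ i, c i) * b) (nhdsWithin t (Set.Iio t))
        (nhds ((∑ i, c i) * t)) :=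
      ((continuous_const.mul continuous_id).tendsto t).mono_left nhdsWithin_le_nhds
    refine le_of_tendsto hlim ?_
    filter_upwards [self_mem_nhdsWithin] with b hb
    rw [← hconst]
    exact (hfU _ fun _ => hb).le
  have hpos : 0 < ∑ i, c i := by
    refine (Finset.sum_nonneg fun i _ => hc0 i).lt_of_ne' fun h0 => ?_
    have hz : ∀ i, c i = 0 := fun i =>
      (Finset.sum_eq_zero_iff_of_nonneg fun i _ => hc0 i).1 h0 i (Finset.mem_univ i)
    obtain ⟨x, hx⟩ := hne
    have h1 := hfA x hx
    have h2 := hfU (fun _ => t - 1) fun _ => by linarith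
    simp only [hf, hz, zero_mul, Finset.sum_const_zero] at h1 h2
    linarith
  refine ⟨fun i => c i / ∑ j, c j, ⟨fun i => div_nonneg (hc0 i) hpos.le, ?_⟩, fun x hx => ?_⟩
  · rw [← Finset.sum_div, div_self hpos.ne']
  · have h1 := hfA x hx
    rw [hf] at h1
    simp_rw [div_mul_eq_mul_div]
    rw [← Finset.sum_div, le_div_iff₀ hpos]
    linarith

section Weights
variable {S : Type*}

theorem inE_zero : inE (0 : S → ℝ) := ⟨fun _ => le_rfl, summable_zero, by simp⟩

theorem inE_single [DecidableEq S] (s : S) : inE (Pi.single s (1 : ℝ)) :=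
  ⟨fun j => by
    by_cases hj : j = s
    · subst hj; simp
    · simp [hj], (hasSum_pi_single s (1 : ℝ)).summable, (tsum_pi_single s (1 : ℝ)).le⟩

theorem inE.summable_mul {e : S → ℝ} (he : inE e) {C : ℝ} {a : S → ℝ} (h0 : ∀ s, 0 ≤ a s)
    (hC : ∀ s, a s ≤ C) : Summable fun s => e s * a s :=
  Summable.of_nonneg_of_le (fun s => mul_nonneg (he.1 s) (h0 s))
    (fun s => mul_le_mul_of_nonneg_left (hC s) (he.1 s)) (he.2.1.mul_right C)

theorem inE.tsum_mul_le_iSup {e : S → ℝ} (he : inE e) {C : ℝ} {a : S → ℝ} (h0 : ∀ s, 0 ≤ a s)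
    (hC : ∀ s, a s ≤ C) : ∑' s, e s * a s ≤ ⨆ s, a s := by
  have hb : BddAbove (Set.range a) := ⟨C, by rintro _ ⟨s, rfl⟩; exact hC s⟩
  calc ∑' s, e s * a s ≤ ∑' s, e s * ⨆ s, a s :=
        (he.summable_mul h0 hC).tsum_le_tsum
          (fun s => mul_le_mul_of_nonneg_left (le_ciSup hb s) (he.1 s)) (he.2.1.mul_right _)
    _ = (∑' s, e s) * ⨆ s, a s := tsum_mul_right
    _ ≤ ⨆ s, a s := mul_le_of_le_one_left (Real.iSup_nonneg h0) he.2.2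

theorem iSup_eq_sSup_inE {C : ℝ} {a : S → ℝ} (h0 : ∀ s, 0 ≤ a s) (hC : ∀ s, a s ≤ C) :
    ⨆ s, a s = sSup {t | ∃ e : S → ℝ, inE e ∧ t = ∑' s, e s * a s} := by
  classical
  have hb : BddAbove {t | ∃ e : S → ℝ, inE e ∧ t = ∑' s, e s * a s} :=
    ⟨⨆ s, a s, by rintro _ ⟨e, he, rfl⟩; exact he.tsum_mul_le_iSup h0 hC⟩
  refine le_antisymm (Real.iSup_le (fun s => le_csSup hb ⟨_, inE_single s, ?_⟩)
    (le_csSup hb ⟨0, inE_zero, by simp⟩)) (csSup_le ⟨_, 0, inE_zero, rfl⟩ ?_)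
  · rw [tsum_eq_single s fun j hj => by simp [hj]]
    simp
  · rintro _ ⟨e, he, rfl⟩
    exact he.tsum_mul_le_iSup h0 hC

/-- Extending a point of a finite simplex by zero gives a weight. -/
theorem exists_inE_of_stdSimplex (F : Finset S) {w : F → ℝ} (hw : w ∈ stdSimplex ℝ F) :
    ∃ e : S → ℝ, inE e ∧ ∀ a : S → ℝ, ∑' s, e s * a s = ∑ i, w i * a i := by
  classical
  set e : S → ℝ := fun s => if h : s ∈ F then w ⟨s, h⟩ else 0 with he
  have hsupp : ∀ s ∉ F, e s = 0 := fun s hs => by simp [he, hs]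
  have heq : ∀ i : F, e i = w i := fun i => by simp [he]
  have hsum : ∀ a : S → ℝ, ∑' s, e s * a s = ∑ i, w i * a i := fun a => by
    rw [tsum_eq_sum (s := F) fun s hs => by rw [hsupp s hs, zero_mul], ← Finset.sum_coe_sort]
    exact Finset.sum_congr rfl fun i _ => by rw [heq]
  refine ⟨e, ⟨fun s => ?_, summable_of_ne_finset_zero (s := F) hsupp, ?_⟩, hsum⟩
  · by_cases hs : s ∈ F
    · simpa [he, hs] using hw.1 ⟨s, hs⟩
    · exact (hsupp s hs).ge
  · have h1 := hsum fun _ => 1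
    simp_rw [mul_one] at h1
    exact (h1.trans hw.2).le

/-- Minimax identity for a compact convex set of bounded nonnegative families. -/
theorem sInf_iSup_eq_sSup_sInf {C : ℝ} {A : Set (S → ℝ)} (hconv : Convex ℝ A)
    (hcomp : IsCompact A) (hne : A.Nonempty) (h0 : ∀ a ∈ A, ∀ s, 0 ≤ a s)
    (hC : ∀ a ∈ A, ∀ s, a s ≤ C) :
    sInf {r | ∃ a ∈ A, r = ⨆ s, a s} =
      sSup {r | ∃ e : S → ℝ, inE e ∧ r = sInf {t | ∃ a ∈ A, t = ∑' s, e s * a s}} := by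
  set V := {r | ∃ e : S → ℝ, inE e ∧ r = sInf {t | ∃ a ∈ A, t = ∑' s, e s * a s}}
  have hweak : ∀ e : S → ℝ, inE e → ∀ a ∈ A,
      sInf {t | ∃ a ∈ A, t = ∑' s, e s * a s} ≤ ⨆ s, a s := fun e he a ha => by
    refine le_trans (csInf_le ⟨0, ?_⟩ ⟨a, ha, rfl⟩) (he.tsum_mul_le_iSup (h0 a ha) (hC a ha))
    rintro _ ⟨b, hb, rfl⟩
    exact tsum_nonneg fun s => mul_nonneg (he.1 s) (h0 b hb s)
  obtain ⟨a₀, ha₀⟩ := hne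
  have hAne : ∀ e : S → ℝ, {t | ∃ a ∈ A, t = ∑' s, e s * a s}.Nonempty := fun e =>
    ⟨_, a₀, ha₀, rfl⟩
  have hVb : BddAbove V := ⟨⨆ s, a₀ s, by rintro _ ⟨e, he, rfl⟩; exact hweak e he a₀ ha₀⟩
  have hV0 : 0 ≤ sSup V := by
    refine le_csSup hVb ⟨0, inE_zero, ?_⟩
    have : {t : ℝ | ∃ a ∈ A, t = ∑' s, (0 : S → ℝ) s * a s} = {0} := by
      ext t
      simpa using fun _ => ⟨a₀, ha₀⟩
    rw [this, csInf_singleton]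
  refine le_antisymm (le_of_forall_gt_imp_ge_of_dense fun t ht => ?_) ?_
  · suffices hex : (A ∩ ⋂ s, {a : S → ℝ | a s ≤ t}).Nonempty by
      obtain ⟨a, ha, hat⟩ := hex
      rw [Set.mem_iInter] at hat
      refine le_trans (csInf_le ⟨0, ?_⟩ ⟨a, ha, rfl⟩) (Real.iSup_le hat (hV0.trans ht.le))
      rintro _ ⟨b, hb, rfl⟩
      exact Real.iSup_nonneg (h0 b hb)
    refine hcomp.inter_iInter_nonempty _
      (fun s => isClosed_le (continuous_apply s) continuous_const) fun F => ?_
    by_contra hemp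
    have hF : ∀ a ∈ A, ∃ i : F, t ≤ a i := fun a ha => by
      by_contra! hlt
      exact hemp ⟨a, ha, Set.mem_iInter₂.2 fun s hs => (hlt ⟨s, hs⟩).le⟩
    let R : (S → ℝ) →ₗ[ℝ] (F → ℝ) := LinearMap.funLeft ℝ ℝ Subtype.val
    obtain ⟨w, hw, hwA⟩ := exists_stdSimplex_forall_le_sum (hconv.linear_image R)
      ⟨R a₀, a₀, ha₀, rfl⟩ (t := t) (by
        rintro _ ⟨a, ha, rfl⟩
        exact hF a ha)
    obtain ⟨e, he, hsum⟩ := exists_inE_of_stdSimplex F hw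
    refine absurd ht (not_lt.2 (le_csSup_of_le hVb ⟨e, he, rfl⟩ (le_csInf (hAne e) ?_)))
    rintro _ ⟨a, ha, rfl⟩
    rw [hsum]
    exact hwA _ ⟨a, ha, rfl⟩
  · refine csSup_le ⟨_, 0, inE_zero, rfl⟩ ?_
    rintro _ ⟨e, he, rfl⟩
    refine le_csInf ⟨_, a₀, ha₀, rfl⟩ ?_
    rintro _ ⟨a, ha, rfl⟩
    exact hweak e he a ha

end Weights

theorem isCompact_couplings {X Y : Type*} [TopologicalSpace X] [PolishSpace X] [MeasurableSpace X]
    [BorelSpace X] [TopologicalSpace Y] [PolishSpace Y] [MeasurableSpace Y] [BorelSpace Y]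
    (μ : Measure X) (ν : Measure Y) [IsProbabilityMeasure μ] [IsProbabilityMeasure ν] :
    IsCompact {m : ProbabilityMeasure (X × Y) |
      (m : Measure (X × Y)).map Prod.fst = μ ∧ (m : Measure (X × Y)).map Prod.snd = ν} := by
  set K := {m : ProbabilityMeasure (X × Y) |
      (m : Measure (X × Y)).map Prod.fst = μ ∧ (m : Measure (X × Y)).map Prod.snd = ν}
  have hclosed : IsClosed K := by
    let μ' : ProbabilityMeasure X := ⟨μ, inferInstance⟩
    let ν' : ProbabilityMeasure Y := ⟨ν, inferInstance⟩
    have hKeq : K =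
        {m | m.map (continuous_fst.measurable.aemeasurable (μ := (m : Measure (X × Y)))) =
            μ'} ∩
        {m | m.map (continuous_snd.measurable.aemeasurable (μ := (m : Measure (X × Y)))) =
            ν'} := by
      ext m
      exact and_congr
        (ProbabilityMeasure.toMeasure_injective.eq_iff (a := m.map _) (b := μ'))
        (ProbabilityMeasure.toMeasure_injective.eq_iff (a := m.map _) (b := ν'))
    rw [hKeq]
    exact (isClosed_eq (ProbabilityMeasure.continuous_map continuous_fst) continuous_const).inter
      (isClosed_eq (ProbabilityMeasure.continuous_map continuous_snd) continuous_const)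
  rw [← hclosed.closure_eq]
  refine isCompact_closure_of_isTightMeasureSet (IsTightMeasureSet.prodMk ?_ ?_)
  · refine (isTightMeasureSet_singleton (μ := μ)).subset ?_
    rintro _ ⟨_, ⟨m, hm, rfl⟩, rfl⟩
    exact hm.1
  · refine (isTightMeasureSet_singleton (μ := ν)).subset ?_
    rintro _ ⟨_, ⟨m, hm, rfl⟩, rfl⟩
    exact hm.2

section Couplings
variable {S : Type*} {Xs : S → Type*}

section
variable [∀ s, MeasurableSpace (Xs s)]

theorem IsCoupling.convexComb {μ ν : Measure (∀ s, Xs s)}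
    {m₁ m₂ : Measure ((∀ t, Xs t) × (∀ t, Xs t))} (h₁ : IsCoupling μ ν m₁)
    (h₂ : IsCoupling μ ν m₂) {a b : ENNReal} (hab : a + b = 1) :
    IsCoupling μ ν (a • m₁ + b • m₂) := by
  constructor
  · rw [Measure.map_add _ _ measurable_fst, Measure.map_smul, Measure.map_smul, h₁.1, h₂.1,
      ← add_smul, hab, one_smul]
  · rw [Measure.map_add _ _ measurable_snd, Measure.map_smul, Measure.map_smul, h₁.2, h₂.2,
      ← add_smul, hab, one_smul]

theorem isCoupling_prod (μ ν : Measure (∀ s, Xs s)) [IsProbabilityMeasure μ]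
    [IsProbabilityMeasure ν] : IsCoupling μ ν (μ.prod ν) :=
  ⟨Measure.fst_prod, Measure.snd_prod⟩

end

variable [∀ s, MetricSpace (Xs s)]

theorem continuous_dd (s : S) : Continuous (dd (Xs := Xs) s) := by
  unfold dd
  fun_prop

variable [Countable S] [∀ s, PolishSpace (Xs s)] [∀ s, MeasurableSpace (Xs s)]
  [∀ s, BorelSpace (Xs s)]

theorem integrable_dd {C : ℝ} {s : S} (hC : ∀ a b : Xs s, dist a b ≤ C)
    (m : Measure ((∀ t, Xs t) × (∀ t, Xs t))) [IsFiniteMeasure m] : Integrable (dd s) m :=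
  Integrable.of_bound (continuous_dd s).aestronglyMeasurable C <| Filter.Eventually.of_forall
    fun p => by simpa [dd] using hC (p.1 s) (p.2 s)

theorem integral_ce {C : ℝ} (hC : ∀ s, ∀ a b : Xs s, dist a b ≤ C) {e : S → ℝ} (he : inE e)
    (m : Measure ((∀ t, Xs t) × (∀ t, Xs t))) [IsProbabilityMeasure m] :
    ∫ p, ce e p.1 p.2 ∂m = ∑' s, e s * ∫ p, dd s p ∂m := by
  have hint : ∀ s, Integrable (fun p => e s * dd s p) m := fun s =>
    (integrable_dd (hC s) m).const_mul _
  have hnorm : ∀ s (p : (∀ t, Xs t) × (∀ t, Xs t)), ‖e s * dd s p‖ = e s * dd s p := fun s p =>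
    Real.norm_of_nonneg (mul_nonneg (he.1 s) dist_nonneg)
  have hsum : Summable fun s => ∫ p, ‖e s * dd s p‖ ∂m := by
    simp_rw [hnorm, integral_const_mul]
    refine he.summable_mul (C := C) (fun s => integral_nonneg fun p => dist_nonneg) fun s => ?_
    simpa using integral_mono (integrable_dd (hC s) m) (integrable_const C) fun p => hC s _ _
  have h := integral_tsum_of_summable_integral_norm hint hsum
  simp_rw [integral_const_mul] at h
  exact h.symm

variable (Xs) in
/-- The families of coordinate costs realised by couplings of `μ` and `ν`. -/
def couplingCosts (μ ν : Measure (∀ s, Xs s)) : Set (S → ℝ) :=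
  {a | ∃ m : Measure ((∀ t, Xs t) × (∀ t, Xs t)), IsProbabilityMeasure m ∧ IsCoupling μ ν m ∧
    a = fun s => ∫ p, dd s p ∂m}

theorem convex_couplingCosts {C : ℝ} (hC : ∀ s, ∀ a b : Xs s, dist a b ≤ C)
    (μ ν : Measure (∀ s, Xs s)) : Convex ℝ (couplingCosts Xs μ ν) := by
  rintro _ ⟨m₁, _, h₁, rfl⟩ _ ⟨m₂, _, h₂, rfl⟩ a b ha hb hab
  have hab' : ENNReal.ofReal a + ENNReal.ofReal b = 1 := by
    rw [← ENNReal.ofReal_add ha hb, hab, ENNReal.ofReal_one]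
  refine ⟨ENNReal.ofReal a • m₁ + ENNReal.ofReal b • m₂, ⟨by simp [hab']⟩,
    h₁.convexComb h₂ hab', funext fun s => ?_⟩
  rw [integral_add_measure ((integrable_dd (hC s) m₁).smul_measure ENNReal.ofReal_ne_top)
    ((integrable_dd (hC s) m₂).smul_measure ENNReal.ofReal_ne_top), integral_smul_measure,
    integral_smul_measure, ENNReal.toReal_ofReal ha, ENNReal.toReal_ofReal hb]
  rfl

theorem isCompact_couplingCosts {C : ℝ} (hC : ∀ s, ∀ a b : Xs s, dist a b ≤ C)
    (μ ν : Measure (∀ s, Xs s)) [IsProbabilityMeasure μ] [IsProbabilityMeasure ν] :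
    IsCompact (couplingCosts Xs μ ν) := by
  have hcont : Continuous fun (m : ProbabilityMeasure ((∀ t, Xs t) × (∀ t, Xs t))) (s : S) =>
      ∫ p, dd s p ∂(m : Measure ((∀ t, Xs t) × (∀ t, Xs t))) :=
    continuous_pi fun s => ProbabilityMeasure.continuous_integral_boundedContinuousFunction
      (BoundedContinuousFunction.ofNormedAddCommGroup (dd s) (continuous_dd s) C fun p => by
        simpa [dd] using hC s (p.1 s) (p.2 s))
  convert (isCompact_couplings μ ν).image hcont using 1
  ext a
  constructor
  · rintro ⟨m, hm, hc, rfl⟩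
    exact ⟨⟨m, hm⟩, hc, rfl⟩
  · rintro ⟨m, hc, rfl⟩
    exact ⟨m, inferInstance, hc, rfl⟩

end Couplings

theorem stmt5 {S : Type*} [Countable S] {Xs : S → Type*} [∀ s, MetricSpace (Xs s)]
    [∀ s, PolishSpace (Xs s)] [∀ s, MeasurableSpace (Xs s)] [∀ s, BorelSpace (Xs s)]
    (C : ℝ) (hC : ∀ s, ∀ a b : Xs s, dist a b ≤ C)
    (μ ν : Measure (∀ s, Xs s)) [IsProbabilityMeasure μ] [IsProbabilityMeasure ν] :
    Steif μ ν = sInf {r | ∃ m : Measure ((∀ t, Xs t) × (∀ t, Xs t)),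
        IsProbabilityMeasure m ∧ IsCoupling μ ν m ∧
        r = sSup {t | ∃ e : S → ℝ, inE e ∧ t = ∑' s, e s * ∫ p, dd s p ∂m}} ∧
    Steif μ ν = sSup {r | ∃ e : S → ℝ, inE e ∧
        r = sInf {t | ∃ m : Measure ((∀ t, Xs t) × (∀ t, Xs t)),
          IsProbabilityMeasure m ∧ IsCoupling μ ν m ∧ t = ∑' s, e s * ∫ p, dd s p ∂m}} ∧
    Steif μ ν = sSup {r | ∃ e : S → ℝ, inE e ∧
        r = sInf {t | ∃ m : Measure ((∀ t, Xs t) × (∀ t, Xs t)),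
          IsProbabilityMeasure m ∧ IsCoupling μ ν m ∧ t = ∫ p, ce e p.1 p.2 ∂m}} := by
  have h0 : ∀ a ∈ couplingCosts Xs μ ν, ∀ s, 0 ≤ a s := by
    rintro _ ⟨m, _, _, rfl⟩ s
    exact integral_nonneg fun p => dist_nonneg
  have h1 : ∀ a ∈ couplingCosts Xs μ ν, ∀ s, a s ≤ C := by
    rintro _ ⟨m, _, _, rfl⟩ s
    simpa using integral_mono (integrable_dd (hC s) m) (integrable_const C) fun p => hC s _ _
  have hset : ∀ φ : (S → ℝ) → ℝ,
      {r | ∃ m : Measure ((∀ t, Xs t) × (∀ t, Xs t)), IsProbabilityMeasure m ∧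
        IsCoupling μ ν m ∧ r = φ fun s => ∫ p, dd s p ∂m} =
      {r | ∃ a ∈ couplingCosts Xs μ ν, r = φ a} := fun φ => by
    ext r
    constructor
    · rintro ⟨m, hm, hc, rfl⟩
      exact ⟨_, ⟨m, hm, hc, rfl⟩, rfl⟩
    · rintro ⟨_, ⟨m, hm, hc, rfl⟩, rfl⟩
      exact ⟨m, hm, hc, rfl⟩
  have hminimax : Steif μ ν = sSup {r | ∃ e : S → ℝ, inE e ∧
      r = sInf {t | ∃ m : Measure ((∀ t, Xs t) × (∀ t, Xs t)),
        IsProbabilityMeasure m ∧ IsCoupling μ ν m ∧ t = ∑' s, e s * ∫ p, dd s p ∂m}} := by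
    have hne : (couplingCosts Xs μ ν).Nonempty :=
      ⟨_, μ.prod ν, inferInstance, isCoupling_prod μ ν, rfl⟩
    have := sInf_iSup_eq_sSup_sInf (convex_couplingCosts hC μ ν) (isCompact_couplingCosts hC μ ν)
      hne h0 h1
    simp_rw [← hset (fun a => ⨆ s, a s), ← fun e : S → ℝ => hset (fun a => ∑' s, e s * a s)] at this
    exact this
  refine ⟨?_, hminimax, hminimax.trans ?_⟩
  · unfold Steif
    congr 1
    ext r
    refine exists_congr fun m => and_congr_right fun hm => and_congr_right fun hc => ?_
    rw [iSup_eq_sSup_inE (h0 _ ⟨m, hm, hc, rfl⟩) (h1 _ ⟨m, hm, hc, rfl⟩)]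
  · congr 1
    ext r
    refine exists_congr fun e => and_congr_right fun he => ?_
    suffices h : {t : ℝ | ∃ m : Measure ((∀ t, Xs t) × (∀ t, Xs t)),
        IsProbabilityMeasure m ∧ IsCoupling μ ν m ∧ t = ∑' s, e s * ∫ p, dd s p ∂m} =
        {t | ∃ m : Measure ((∀ t, Xs t) × (∀ t, Xs t)),
          IsProbabilityMeasure m ∧ IsCoupling μ ν m ∧ t = ∫ p, ce e p.1 p.2 ∂m} by rw [h]
    ext t
    refine exists_congr fun m => and_congr_right fun hm => and_congr_right fun _ => ?_
    rw [integral_ce hC he m]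
end

section
/- For each fixed e ∈ E, Kantorovich–Rubinstein duality holds for the pseudometric cost c_e: sup_{f∈F_e} (μ(f) − ν(f)) = inf_{m∈M} ∫ c_e dm, where F_e is the set of functions 1-Lipschitz with respect to c_e and M is the set of couplings of μ and ν. -/
open MeasureTheory

/-- A sublinear functional is supported at every point by a linear functional it dominates. -/
theorem exists_linearMap_eq_le_sublinear {E : Type*} [AddCommGroup E] [Module ℝ E] (N : E → ℝ)
    (N_hom : ∀ c : ℝ, 0 < c → ∀ x, N (c • x) = c * N x)
    (N_add : ∀ x y, N (x + y) ≤ N x + N y) (x₀ : E) :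
    ∃ g : E →ₗ[ℝ] ℝ, g x₀ = N x₀ ∧ ∀ x, g x ≤ N x := by
  have N_zero : N 0 = 0 := by
    have := N_hom 2 two_pos 0
    rw [smul_zero] at this
    linarith
  have H : ∀ c : ℝ, c • x₀ = 0 → (RingHom.id ℝ) c • N x₀ = 0 := by
    intro c hc
    rcases smul_eq_zero.1 hc with rfl | rfl
    · simp
    · simp [N_zero]
  obtain ⟨g, hg, hgN⟩ := exists_extension_of_le_sublinear
    (LinearPMap.mkSpanSingleton' x₀ (N x₀) H) N N_hom N_add (by
      rintro ⟨x, hx⟩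
      obtain ⟨t, rfl⟩ := Submodule.mem_span_singleton.1 hx
      rw [LinearPMap.mkSpanSingleton'_apply]
      simp only [RingHom.id_apply, smul_eq_mul]
      rcases lt_trichotomy t 0 with ht | rfl | ht
      · have h1 := N_add (t • x₀) ((-t) • x₀)
        rw [← add_smul, add_neg_cancel, zero_smul, N_zero, N_hom (-t) (neg_pos.2 ht)] at h1
        linarith
      · simp [N_zero]
      · exact (N_hom t ht x₀).ge)
  refine ⟨g, ?_, hgN⟩
  rw [hg ⟨x₀, Submodule.mem_span_singleton_self x₀⟩]
  exact LinearPMap.mkSpanSingleton'_apply_self _ _ _ _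

/-- Duality for the finite transport problem with cost `c` and marginals `a`, `b`. -/
theorem exists_transport_plan_potentials {ι κ : Type*} [Fintype ι] [Fintype κ]
    {a : ι → ℝ} {b : κ → ℝ} (ha : ∀ i, 0 ≤ a i) (hb : ∀ j, 0 ≤ b j)
    (ha1 : ∑ i, a i = 1) (hb1 : ∑ j, b j = 1) (c : ι → κ → ℝ) {ε : ℝ} (hε : 0 < ε) :
    ∃ (π : ι → κ → ℝ) (φ : ι → ℝ) (ψ : κ → ℝ), (∀ i j, 0 ≤ π i j) ∧ (∀ i, ∑ j, π i j = a i) ∧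
      (∀ j, ∑ i, π i j = b j) ∧ (∀ i j, φ i + ψ j ≤ c i j) ∧
      ∑ i, ∑ j, π i j * c i j ≤ ∑ i, a i * φ i + ∑ j, b j * ψ j + ε := by
  classical
  let A : (ι × κ → ℝ) → Set ℝ := fun h => {r | ∃ (φ : ι → ℝ) (ψ : κ → ℝ),
    (∀ k, h k ≤ φ k.1 + ψ k.2) ∧ r = ∑ i, a i * φ i + ∑ j, b j * ψ j}
  have A_nonempty (h) : (A h).Nonempty := by
    refine ⟨_, fun _ => ∑ k, |h k|, fun _ => 0, fun k => ?_, rfl⟩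
    rw [add_zero]
    exact (le_abs_self _).trans
      (Finset.single_le_sum (f := fun k => |h k|) (fun k _ => abs_nonneg _) (Finset.mem_univ k))
  have A_bdd (h) : BddBelow (A h) := by
    refine ⟨∑ i, ∑ j, a i * b j * h (i, j), ?_⟩
    rintro _ ⟨φ, ψ, hφ, rfl⟩
    calc ∑ i, ∑ j, a i * b j * h (i, j)
        ≤ ∑ i, ∑ j, a i * b j * (φ i + ψ j) :=
          Finset.sum_le_sum fun i _ => Finset.sum_le_sum fun j _ =>
            mul_le_mul_of_nonneg_left (hφ (i, j)) (mul_nonneg (ha i) (hb j))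
      _ = (∑ i, a i * φ i) * ∑ j, b j + (∑ i, a i) * ∑ j, b j * ψ j := by
          simp_rw [Finset.sum_mul_sum, ← Finset.sum_add_distrib]
          exact Finset.sum_congr rfl fun i _ => Finset.sum_congr rfl fun j _ => by ring
      _ = _ := by rw [ha1, hb1, mul_one, one_mul]
  have hom_le (t : ℝ) (ht : 0 < t) (h) : sInf (A (t • h)) ≤ t * sInf (A h) := by
    rw [← div_le_iff₀' ht]
    refine le_csInf (A_nonempty h) ?_
    rintro _ ⟨φ, ψ, hφ, rfl⟩
    rw [div_le_iff₀' ht]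
    refine csInf_le (A_bdd _) ⟨t • φ, t • ψ, fun k => ?_, ?_⟩
    · simp only [Pi.smul_apply, smul_eq_mul, ← mul_add]
      exact mul_le_mul_of_nonneg_left (hφ k) ht.le
    · simp only [Pi.smul_apply, smul_eq_mul, mul_add, Finset.mul_sum]
      congr 1 <;> exact Finset.sum_congr rfl fun _ _ => by ring
  obtain ⟨L, hL, hLA⟩ := exists_linearMap_eq_le_sublinear (fun h => sInf (A h))
    (fun t ht h => by
      refine (hom_le t ht h).antisymm ?_
      have := hom_le t⁻¹ (inv_pos.2 ht) (t • h)
      rwa [inv_smul_smul₀ ht.ne', ← div_eq_inv_mul, le_div_iff₀' ht] at this)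
    (fun h h' => by
      rw [← sub_le_iff_le_add]
      refine le_csInf (A_nonempty h) ?_
      rintro _ ⟨φ, ψ, hφ, rfl⟩
      rw [sub_le_iff_le_add', ← sub_le_iff_le_add]
      refine le_csInf (A_nonempty h') ?_
      rintro _ ⟨φ', ψ', hφ', rfl⟩
      rw [sub_le_iff_le_add]
      refine csInf_le (A_bdd _) ⟨φ + φ', ψ + ψ', fun k => ?_, ?_⟩
      · simp only [Pi.add_apply]
        linarith [hφ k, hφ' k]
      · simp only [Pi.add_apply, mul_add, Finset.sum_add_distrib]
        ring)
    (fun k => -c k.1 k.2)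
  set π : ι → κ → ℝ := fun i j => L fun k => if (i, j) = k then 1 else 0 with hπ
  have L_apply (h : ι × κ → ℝ) : L h = ∑ i, ∑ j, h (i, j) * π i j := by
    rw [LinearMap.pi_apply_eq_sum_univ L h, Fintype.sum_prod_type]
    rfl
  have L_le (h : ι × κ → ℝ) (φ : ι → ℝ) (ψ : κ → ℝ) (hφ : ∀ k, h k ≤ φ k.1 + ψ k.2) :
      L h ≤ ∑ i, a i * φ i + ∑ j, b j * ψ j :=
    (hLA h).trans (csInf_le (A_bdd h) ⟨φ, ψ, hφ, rfl⟩)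
  have row (t : ℝ) (i : ι) : t * ∑ j, π i j ≤ t * a i := by
    have := L_le (fun k => if k.1 = i then t else 0) (fun i' => if i' = i then t else 0) 0
      (fun k => by simp)
    rw [L_apply] at this
    simpa [Finset.sum_comm (γ := κ), ← Finset.mul_sum, mul_comm] using this
  have col (t : ℝ) (j : κ) : t * ∑ i, π i j ≤ t * b j := by
    have := L_le (fun k => if k.2 = j then t else 0) 0 (fun j' => if j' = j then t else 0)
      (fun k => by simp)
    rw [L_apply] at this
    simpa [← Finset.mul_sum, mul_comm] using this
  obtain ⟨_, ⟨φ, ψ, hφ, rfl⟩, hlt⟩ := exists_lt_of_csInf_lt (A_nonempty fun k => -c k.1 k.2)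
    (lt_add_of_pos_right _ hε)
  refine ⟨π, -φ, -ψ, fun i j => ?_, fun i => ?_, fun j => ?_, fun i j => ?_, ?_⟩
  · have := L_le (-fun k => if (i, j) = k then 1 else 0) 0 0 (fun k => by
      simp only [Pi.neg_apply, Pi.zero_apply]; split_ifs <;> norm_num)
    rw [map_neg] at this
    simpa using this
  · linarith [row 1 i, row (-1) i]
  · linarith [col 1 j, col (-1) j]
  · have := hφ (i, j)
    simp only [Pi.neg_apply] at this ⊢
    linarith
  · rw [← hL, L_apply] at hlt
    simp only [Pi.neg_apply, mul_neg, neg_mul, Finset.sum_neg_distrib] at hlt ⊢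
    simp_rw [mul_comm (π _ _)]
    linarith

theorem ae_map_real_singleton_ne_zero {Z τ : Type*} [MeasurableSpace Z] [Countable τ]
    [MeasurableSpace τ] [MeasurableSingletonClass τ] (ρ : Measure Z) [IsFiniteMeasure ρ]
    {f : Z → τ} (hf : Measurable f) : ∀ᵐ z ∂ρ, (ρ.map f).real {f z} ≠ 0 := by
  refine ae_of_ae_map (p := fun t => (ρ.map f).real {t} ≠ 0) hf.aemeasurable ?_
  rw [ae_iff_of_countable]
  intro t ht
  exact (measureReal_ne_zero_iff).2 ht

theorem lintegral_ofReal_comp_eq_sum {Z τ : Type*} [MeasurableSpace Z] [Fintype τ]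
    [MeasurableSpace τ] [MeasurableSingletonClass τ] (ρ : Measure Z) [IsFiniteMeasure ρ]
    {f : Z → τ} (hf : Measurable f) {w : τ → ℝ} (hw : ∀ t, 0 ≤ w t) :
    ∫⁻ z, ENNReal.ofReal (w (f z)) ∂ρ = ENNReal.ofReal (∑ t, w t * (ρ.map f).real {t}) := by
  rw [← lintegral_map (f := fun t => ENNReal.ofReal (w t)) (measurable_of_finite _) hf,
    lintegral_fintype, ENNReal.ofReal_sum_of_nonneg fun t _ => mul_nonneg (hw t) (by positivity)]
  refine Finset.sum_congr rfl fun t _ => ?_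
  rw [ENNReal.ofReal_mul (hw t), ofReal_measureReal]

theorem integral_comp_eq_sum {Z τ : Type*} [MeasurableSpace Z] [Fintype τ]
    [MeasurableSpace τ] [MeasurableSingletonClass τ] (ρ : Measure Z) [IsFiniteMeasure ρ]
    {f : Z → τ} (hf : Measurable f) (w : τ → ℝ) :
    ∫ z, w (f z) ∂ρ = ∑ t, (ρ.map f).real {t} * w t := by
  rw [← integral_map (f := w) hf.aemeasurable (measurable_of_finite w).aestronglyMeasurable,
    integral_fintype .of_finite]
  rfl

/-- A transport plan between the laws of two finitely valued variables lifts to a coupling. -/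
theorem exists_coupling_of_plan {X Y ι κ : Type*} [MeasurableSpace X] [MeasurableSpace Y]
    [Fintype ι] [Fintype κ] [MeasurableSpace ι] [MeasurableSpace κ]
    [MeasurableSingletonClass ι] [MeasurableSingletonClass κ]
    (μ : Measure X) (ν : Measure Y) [IsProbabilityMeasure μ] [IsProbabilityMeasure ν]
    {g : X → ι} {k : Y → κ} (hg : Measurable g) (hk : Measurable k) {π : ι → κ → ℝ}
    (hπ : ∀ i j, 0 ≤ π i j) (hrow : ∀ i, ∑ j, π i j = (μ.map g).real {i})
    (hcol : ∀ j, ∑ i, π i j = (ν.map k).real {j}) :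
    ∃ m : Measure (X × Y), m.map Prod.fst = μ ∧ m.map Prod.snd = ν ∧
      ∀ F : ι → κ → ℝ, ∫ p, F (g p.1) (k p.2) ∂m = ∑ i, ∑ j, π i j * F i j := by
  set a : ι → ℝ := fun i => (μ.map g).real {i}
  set b : κ → ℝ := fun j => (ν.map k).real {j}
  have hab (i j) : a i * b j = 0 → π i j = 0 := by
    intro h
    rcases mul_eq_zero.1 h with h | h
    · exact (Finset.sum_eq_zero_iff_of_nonneg fun j _ => hπ i j).1 ((hrow i).trans h) j
        (Finset.mem_univ j)
    · exact (Finset.sum_eq_zero_iff_of_nonneg fun i _ => hπ i j).1 ((hcol j).trans h) i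
        (Finset.mem_univ i)
  set w : ι → κ → ℝ := fun i j => π i j / (a i * b j)
  have hw0 (i j) : 0 ≤ w i j := div_nonneg (hπ i j) (by positivity)
  have hwmul (i j) : w i j * (a i * b j) = π i j := div_mul_cancel_of_imp (hab i j)
  set W : X × Y → ENNReal := fun p => ENNReal.ofReal (w (g p.1) (k p.2))
  have hgk : Measurable (Prod.map g k) := hg.prodMap hk
  have hWm : Measurable W :=
    (measurable_of_finite fun q : ι × κ => ENNReal.ofReal (w q.1 q.2)).comp hgk
  refine ⟨(μ.prod ν).withDensity W, ?_, ?_, fun F => ?_⟩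
  · ext s hs
    rw [Measure.map_apply measurable_fst hs, withDensity_apply _ (measurable_fst hs),
      ← Set.prod_univ, ← Measure.prod_restrict, Measure.restrict_univ,
      lintegral_prod _ hWm.aemeasurable, ← setLIntegral_one]
    refine lintegral_congr_ae (ae_restrict_of_ae ?_)
    filter_upwards [ae_map_real_singleton_ne_zero μ hg] with x hx
    rw [lintegral_ofReal_comp_eq_sum ν hk (hw0 (g x)), ← ENNReal.ofReal_one]
    congr 1
    refine mul_left_cancel₀ hx ?_
    rw [mul_one, Finset.mul_sum]
    refine (Finset.sum_congr rfl fun j _ => ?_).trans (hrow (g x))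
    rw [← hwmul, mul_left_comm]
  · ext s hs
    rw [Measure.map_apply measurable_snd hs, withDensity_apply _ (measurable_snd hs),
      ← Set.univ_prod, ← Measure.prod_restrict, Measure.restrict_univ,
      lintegral_prod_symm' _ hWm, ← setLIntegral_one]
    refine lintegral_congr_ae (ae_restrict_of_ae ?_)
    filter_upwards [ae_map_real_singleton_ne_zero ν hk] with y hy
    rw [lintegral_ofReal_comp_eq_sum μ hg fun i => hw0 i (k y), ← ENNReal.ofReal_one]
    congr 1
    refine mul_left_cancel₀ hy ?_
    rw [mul_one, Finset.mul_sum]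
    refine (Finset.sum_congr rfl fun i _ => ?_).trans (hcol (k y))
    rw [← hwmul, mul_left_comm, mul_comm (b (k y))]
  · rw [integral_withDensity_eq_integral_toReal_smul hWm (ae_of_all _ fun _ => by simp [W])]
    have h := integral_comp_eq_sum (μ.prod ν) hgk fun q : ι × κ => w q.1 q.2 * F q.1 q.2
    rw [← Measure.map_prod_map μ ν hg hk, Fintype.sum_prod_type] at h
    simp only [W, ENNReal.toReal_ofReal (hw0 _ _), smul_eq_mul]
    refine h.trans (Finset.sum_congr rfl fun i _ => Finset.sum_congr rfl fun j _ => ?_)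
    rw [← Set.singleton_prod_singleton, measureReal_prod_prod, ← hwmul]
    ring

open Filter Topology in
/-- The identity of a bounded separable space is approximated in mean by simple functions. -/
theorem exists_simpleFunc_integral_dist_lt {X : Type*} [PseudoMetricSpace X] [MeasurableSpace X]
    [OpensMeasurableSpace X] [SecondCountableTopology X] {C : ℝ} (hC : ∀ x y : X, dist x y ≤ C)
    (μ ν : Measure X) [IsProbabilityMeasure μ] [IsProbabilityMeasure ν] {δ : ℝ} (hδ : 0 < δ) :
    ∃ g : SimpleFunc X X, ∫ x, dist x (g x) ∂μ < δ ∧ ∫ x, dist x (g x) ∂ν < δ := by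
  have : Nonempty X := nonempty_of_isProbabilityMeasure μ
  set g : ℕ → SimpleFunc X X := SimpleFunc.nearestPt (TopologicalSpace.denseSeq X)
  have key (ρ : Measure X) [IsProbabilityMeasure ρ] :
      Tendsto (fun n => ∫ x, dist x (g n x) ∂ρ) atTop (𝓝 0) := by
    rw [← integral_zero X ℝ (μ := ρ)]
    refine tendsto_integral_of_dominated_convergence (fun _ => C) (fun n => ?_)
      (integrable_const C) (fun n => ae_of_all _ fun x => ?_) (ae_of_all _ fun x => ?_)
    · exact (measurable_dist.comp
        (measurable_id.prodMk (g n).measurable)).aestronglyMeasurable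
    · rw [Real.norm_of_nonneg dist_nonneg]
      exact hC _ _
    · have h : Tendsto (fun n => g n x) atTop (𝓝 x) :=
        SimpleFunc.tendsto_nearestPt (TopologicalSpace.denseRange_denseSeq X x)
      simpa using (tendsto_const_nhds (x := x)).dist h
  obtain ⟨n, hn⟩ := (((key μ).eventually_lt_const hδ).and
    ((key ν).eventually_lt_const hδ)).exists
  exact ⟨g n, hn⟩

theorem integrable_comp_of_sub_le_dist {X Z : Type*} [PseudoMetricSpace X] [MeasurableSpace X]
    [MeasurableSpace Z] {C : ℝ} (hC : ∀ x y : X, dist x y ≤ C) {f : X → ℝ} (hf : Measurable f)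
    (hlip : ∀ x y, f x - f y ≤ dist x y) (ρ : Measure Z) [IsProbabilityMeasure ρ] {u : Z → X}
    (hu : Measurable u) : Integrable (fun z => f (u z)) ρ := by
  obtain ⟨z₀⟩ : Nonempty Z := nonempty_of_isProbabilityMeasure ρ
  refine .of_bound (hf.comp hu).aestronglyMeasurable (|f (u z₀)| + C) (ae_of_all _ fun z => ?_)
  rw [Real.norm_eq_abs, abs_le]
  constructor <;> linarith [le_abs_self (f (u z₀)), neg_abs_le (f (u z₀)), hlip (u z) (u z₀),
    hlip (u z₀) (u z), hC (u z) (u z₀), hC (u z₀) (u z)]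

theorem integrable_dist_comp {X Z : Type*} [PseudoMetricSpace X] [MeasurableSpace X]
    [OpensMeasurableSpace X] [SecondCountableTopology X] [MeasurableSpace Z] {C : ℝ}
    (hC : ∀ x y : X, dist x y ≤ C) (ρ : Measure Z) [IsFiniteMeasure ρ] {u v : Z → X}
    (hu : Measurable u) (hv : Measurable v) : Integrable (fun z => dist (u z) (v z)) ρ :=
  .of_bound (hu.dist hv).aestronglyMeasurable C
    (ae_of_all _ fun z => by rw [Real.norm_of_nonneg dist_nonneg]; exact hC _ _)

/-- Up to `ε`, a bounded separable pseudometric space admits a coupling whose cost is matched by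
a nonexpansive function. -/
theorem exists_lipschitz_coupling_integral_dist_le {X : Type*} [PseudoMetricSpace X]
    [MeasurableSpace X] [OpensMeasurableSpace X] [SecondCountableTopology X] {C : ℝ}
    (hC : ∀ x y : X, dist x y ≤ C) (μ ν : Measure X) [IsProbabilityMeasure μ]
    [IsProbabilityMeasure ν] {ε : ℝ} (hε : 0 < ε) :
    ∃ (f : X → ℝ) (m : Measure (X × X)), Measurable f ∧ (∀ x y, f x - f y ≤ dist x y) ∧
      m.map Prod.fst = μ ∧ m.map Prod.snd = ν ∧
      ∫ p, dist p.1 p.2 ∂m ≤ ∫ x, f x ∂μ - ∫ x, f x ∂ν + ε := by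
  have : Nonempty X := nonempty_of_isProbabilityMeasure μ
  set δ := ε / 5 with hδ_def
  have hδ : 0 < δ := by positivity
  obtain ⟨g, hgμ, hgν⟩ := exists_simpleFunc_integral_dist_lt hC μ ν hδ
  let ι := g.range
  let _ : MeasurableSpace ι := ⊤
  let q : X → ι := fun x => ⟨g x, g.mem_range_self x⟩
  have hq : Measurable q := by
    intro s _
    have : q ⁻¹' s = g ⁻¹' (Subtype.val '' s) := by
      ext x; simp [q, ι]
    rw [this]
    exact g.measurableSet_preimage _
  have : Nonempty ι := ⟨q (Classical.arbitrary X)⟩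
  have := Measure.isProbabilityMeasure_map hq.aemeasurable (μ := μ)
  have := Measure.isProbabilityMeasure_map hq.aemeasurable (μ := ν)
  have sum_one (ρ : Measure ι) [IsProbabilityMeasure ρ] : ∑ i, ρ.real {i} = 1 := by
    simp
  obtain ⟨π, φ, ψ, hπ, hrow, hcol, hφψ, hcost⟩ := exists_transport_plan_potentials
    (a := fun i => (μ.map q).real {i}) (b := fun i => (ν.map q).real {i})
    (fun _ => measureReal_nonneg) (fun _ => measureReal_nonneg) (sum_one _) (sum_one _)
    (fun i j => dist (i : X) j) hδ
  obtain ⟨m, hm1, hm2, hmF⟩ := exists_coupling_of_plan μ ν hq hq hπ hrow hcol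
  have hmprob : IsProbabilityMeasure m := by
    have : IsProbabilityMeasure (m.map Prod.fst) := hm1 ▸ inferInstance
    exact Measure.isProbabilityMeasure_of_map Prod.fst
  set f : X → ℝ := fun x => ⨅ i : ι, (dist x i - ψ i)
  have f_le (x) (i : ι) : f x ≤ dist x i - ψ i :=
    ciInf_le (Set.finite_range _).bddBelow i
  have f_lip (x y) : f x - f y ≤ dist x y := by
    rw [sub_le_comm]
    refine le_ciInf fun i => ?_
    linarith [f_le x i, dist_triangle x y i]
  have f_meas : Measurable f := by
    refine (LipschitzWith.of_le_add fun x y => ?_ : LipschitzWith 1 f).continuous.measurable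
    linarith [f_lip x y]
  have hg := g.measurable
  have hd : Measurable fun x => dist x (g x) := measurable_dist.comp (measurable_id.prodMk hg)
  have cost_le : ∫ p, dist p.1 p.2 ∂m ≤
      ∫ x, dist x (g x) ∂μ + ∑ i, ∑ j, π i j * dist (i : X) j + ∫ x, dist x (g x) ∂ν := by
    have e1 : ∫ x, dist x (g x) ∂μ = ∫ p, dist p.1 (g p.1) ∂m := by
      conv_lhs => rw [← hm1]
      exact integral_map measurable_fst.aemeasurable hd.aestronglyMeasurable
    have e2 : ∫ x, dist x (g x) ∂ν = ∫ p, dist p.2 (g p.2) ∂m := by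
      conv_lhs => rw [← hm2]
      exact integral_map measurable_snd.aemeasurable hd.aestronglyMeasurable
    have i1 : Integrable (fun p : X × X => dist p.1 (g p.1)) m :=
      integrable_dist_comp hC m measurable_fst (hg.comp measurable_fst)
    have i2 : Integrable (fun p : X × X => dist p.2 (g p.2)) m :=
      integrable_dist_comp hC m measurable_snd (hg.comp measurable_snd)
    have i3 : Integrable (fun p : X × X => dist (g p.1) (g p.2)) m :=
      integrable_dist_comp hC m (hg.comp measurable_fst) (hg.comp measurable_snd)
    have e3 : ∑ i, ∑ j, π i j * dist (i : X) j = ∫ p, dist (g p.1) (g p.2) ∂m :=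
      (hmF fun i j => dist (i : X) j).symm
    rw [e1, e2, e3, ← integral_add i1 i3,
      ← integral_add (f := fun p => _ + _) (i1.add i3) i2]
    refine integral_mono (integrable_dist_comp hC m measurable_fst measurable_snd) ((i1.add i3).add i2)
      fun p => ?_
    have := dist_triangle4 p.1 (g p.1) (g p.2) p.2
    rwa [dist_comm (g p.2) p.2] at this
  have h1 : ∑ i, (μ.map q).real {i} * φ i ≤ ∫ x, f (g x) ∂μ := by
    rw [integral_comp_eq_sum μ hq fun i => f i]
    refine Finset.sum_le_sum fun i _ => mul_le_mul_of_nonneg_left ?_ measureReal_nonneg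
    exact le_ciInf fun j => le_sub_iff_add_le.2 (hφψ i j)
  have h2 : ∫ x, f (g x) ∂ν ≤ -∑ i, (ν.map q).real {i} * ψ i := by
    rw [integral_comp_eq_sum ν hq fun i => f i, ← Finset.sum_neg_distrib]
    refine Finset.sum_le_sum fun i _ => ?_
    rw [← mul_neg]
    refine mul_le_mul_of_nonneg_left ?_ measureReal_nonneg
    simpa using f_le i i
  have h3 : ∫ x, f (g x) ∂μ ≤ ∫ x, f x ∂μ + ∫ x, dist x (g x) ∂μ := by
    have i1 : Integrable f μ :=
      integrable_comp_of_sub_le_dist hC f_meas f_lip μ measurable_id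
    have i2 : Integrable (fun x => dist x (g x)) μ :=
      integrable_dist_comp hC μ measurable_id hg
    rw [← integral_add i1 i2]
    refine integral_mono (integrable_comp_of_sub_le_dist hC f_meas f_lip μ hg) (i1.add i2) fun x => ?_
    have := f_lip (g x) x
    rw [dist_comm] at this
    exact sub_le_iff_le_add'.1 this
  have h4 : ∫ x, f x ∂ν ≤ ∫ x, f (g x) ∂ν + ∫ x, dist x (g x) ∂ν := by
    have i1 := integrable_comp_of_sub_le_dist hC f_meas f_lip ν hg
    have i2 : Integrable (fun x => dist x (g x)) ν :=
      integrable_dist_comp hC ν measurable_id hg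
    rw [← integral_add i1 i2]
    exact integral_mono (integrable_comp_of_sub_le_dist hC f_meas f_lip ν measurable_id)
      (i1.add i2) fun x => sub_le_iff_le_add'.1 (f_lip x (g x))
  refine ⟨f, m, f_meas, f_lip, hm1, hm2, ?_⟩
  linarith

/-- Kantorovich–Rubinstein duality on a bounded separable pseudometric space. -/
theorem sSup_integral_sub_eq_sInf_integral_dist {X : Type*} [PseudoMetricSpace X]
    [MeasurableSpace X] [OpensMeasurableSpace X] [SecondCountableTopology X] {C : ℝ}
    (hC : ∀ x y : X, dist x y ≤ C) (μ ν : Measure X) [IsProbabilityMeasure μ]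
    [IsProbabilityMeasure ν] :
    sSup {r | ∃ f : X → ℝ, Measurable f ∧ (∀ x y, f x - f y ≤ dist x y) ∧
        r = (∫ x, f x ∂μ) - ∫ x, f x ∂ν} =
      sInf {r | ∃ m : Measure (X × X), IsProbabilityMeasure m ∧
        (m.map Prod.fst = μ ∧ m.map Prod.snd = ν) ∧ r = ∫ p, dist p.1 p.2 ∂m} := by
  set A := {r | ∃ f : X → ℝ, Measurable f ∧ (∀ x y, f x - f y ≤ dist x y) ∧
    r = (∫ x, f x ∂μ) - ∫ x, f x ∂ν}
  set B := {r | ∃ m : Measure (X × X), IsProbabilityMeasure m ∧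
    (m.map Prod.fst = μ ∧ m.map Prod.snd = ν) ∧ r = ∫ p, dist p.1 p.2 ∂m}
  have A_le_B : ∀ r ∈ A, ∀ s ∈ B, r ≤ s := by
    rintro _ ⟨f, hf, hlip, rfl⟩ _ ⟨m, hm, ⟨hm1, hm2⟩, rfl⟩
    have i1 := integrable_comp_of_sub_le_dist hC hf hlip m measurable_fst
    have i2 := integrable_comp_of_sub_le_dist hC hf hlip m measurable_snd
    rw [← hm1, ← hm2, integral_map measurable_fst.aemeasurable hf.aestronglyMeasurable,
      integral_map measurable_snd.aemeasurable hf.aestronglyMeasurable, ← integral_sub i1 i2]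
    exact integral_mono (i1.sub i2) (integrable_dist_comp hC m measurable_fst measurable_snd)
      fun p => hlip p.1 p.2
  have hA : A.Nonempty := ⟨_, fun _ => 0, measurable_const, fun x y => by simp, rfl⟩
  have hB : B.Nonempty := ⟨_, μ.prod ν, inferInstance, ⟨by simp, by simp⟩, rfl⟩
  refine (csSup_le hA fun r hr => le_csInf hB fun s hs => A_le_B r hr s hs).antisymm ?_
  refine le_of_forall_pos_le_add fun ε hε => ?_
  obtain ⟨f, m, hf, hlip, hm1, hm2, hle⟩ :=
    exists_lipschitz_coupling_integral_dist_le hC μ ν hε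
  have hm : IsProbabilityMeasure m := by
    have : IsProbabilityMeasure (m.map Prod.fst) := hm1 ▸ inferInstance
    exact Measure.isProbabilityMeasure_of_map Prod.fst
  obtain ⟨r₀, hr₀⟩ := hA
  obtain ⟨s₀, hs₀⟩ := hB
  calc sInf B ≤ ∫ p, dist p.1 p.2 ∂m :=
        csInf_le ⟨r₀, fun s hs => A_le_B r₀ hr₀ s hs⟩ ⟨m, hm, ⟨hm1, hm2⟩, rfl⟩
    _ ≤ ∫ x, f x ∂μ - ∫ x, f x ∂ν + ε := hle
    _ ≤ sSup A + ε := by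
        gcongr
        exact le_csSup ⟨s₀, fun r hr => A_le_B r hr s₀ hs₀⟩ ⟨f, hf, hlip, rfl⟩

section WeightedCost

variable {S : Type*} {Xs : S → Type*} [∀ s, MetricSpace (Xs s)] {C : ℝ} {e : S → ℝ}

theorem summable_mul_dist (hC : ∀ s, ∀ a b : Xs s, dist a b ≤ C) (he : inE e)
    (x y : ∀ s, Xs s) : Summable fun s => e s * dist (x s) (y s) :=
  .of_nonneg_of_le (fun s => mul_nonneg (he.1 s) dist_nonneg)
    (fun s => mul_le_mul_of_nonneg_left (hC s _ _) (he.1 s)) (he.2.1.mul_right C)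

/-- The pseudometric `ce e` on the product. -/
@[reducible]
noncomputable def cePseudoMetricSpace (hC : ∀ s, ∀ a b : Xs s, dist a b ≤ C) (he : inE e) :
    PseudoMetricSpace (∀ s, Xs s) where
  dist := ce e
  dist_self x := by simp [ce]
  dist_comm x y := by simp [ce, dist_comm]
  dist_triangle x y z := by
    simp only [ce]
    rw [← (summable_mul_dist hC he x y).tsum_add (summable_mul_dist hC he y z)]
    refine (summable_mul_dist hC he x z).tsum_le_tsum (fun s => ?_)
      ((summable_mul_dist hC he x y).add (summable_mul_dist hC he y z))
    rw [← mul_add]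
    exact mul_le_mul_of_nonneg_left (dist_triangle _ _ _) (he.1 s)

theorem continuous_ce_left (hC : ∀ s, ∀ a b : Xs s, dist a b ≤ C) (he : inE e)
    (y : ∀ s, Xs s) : Continuous fun x => ce e x y := by
  refine continuous_tsum (fun s => by fun_prop) (he.2.1.mul_right C) fun s x => ?_
  rw [Real.norm_of_nonneg (mul_nonneg (he.1 s) dist_nonneg)]
  exact mul_le_mul_of_nonneg_left (hC s _ _) (he.1 s)

open Topology in
theorem isOpen_of_isOpen_cePseudoMetricSpace (hC : ∀ s, ∀ a b : Xs s, dist a b ≤ C)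
    (he : inE e) {U : Set (∀ s, Xs s)}
    (hU : IsOpen[(cePseudoMetricSpace hC he).toUniformSpace.toTopologicalSpace] U) :
    IsOpen U := by
  rw [isOpen_iff_mem_nhds]
  intro x hx
  obtain ⟨r, hr, hball⟩ := (@Metric.isOpen_iff _ (cePseudoMetricSpace hC he) U).1 hU x hx
  have hmem : {y | ce e y x < r} ∈ nhds x := by
    refine ((continuous_ce_left hC he x).isOpen_preimage _ isOpen_Iio).mem_nhds ?_
    simpa [ce] using hr
  exact Filter.mem_of_superset hmem fun y hy => hball hy

end WeightedCost

theorem stmt9 {S : Type*} [Countable S] {Xs : S → Type*} [∀ s, MetricSpace (Xs s)]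
    [∀ s, PolishSpace (Xs s)] [∀ s, MeasurableSpace (Xs s)] [∀ s, BorelSpace (Xs s)]
    (C : ℝ) (hC : ∀ s, ∀ a b : Xs s, dist a b ≤ C)
    (μ ν : Measure (∀ s, Xs s)) [IsProbabilityMeasure μ] [IsProbabilityMeasure ν]
    (e : S → ℝ) (he : inE e) :
    sSup {r | ∃ f : (∀ s, Xs s) → ℝ, Measurable f ∧ (∀ x y, f x - f y ≤ ce e x y) ∧
        r = (∫ x, f x ∂μ) - ∫ x, f x ∂ν} =
      sInf {r | ∃ m : Measure ((∀ t, Xs t) × (∀ t, Xs t)), IsProbabilityMeasure m ∧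
        IsCoupling μ ν m ∧ r = ∫ p, ce e p.1 p.2 ∂m} := by
  have hbdd (x y : ∀ s, Xs s) : ce e x y ≤ ∑' s, e s * C :=
    (summable_mul_dist hC he x y).tsum_le_tsum
      (fun s => mul_le_mul_of_nonneg_left (hC s _ _) (he.1 s)) (he.2.1.mul_right C)
  let P : PseudoMetricSpace (∀ s, Xs s) := cePseudoMetricSpace hC he
  have hopen := @OpensMeasurableSpace.mk (∀ s, Xs s) P.toUniformSpace.toTopologicalSpace _
    (MeasurableSpace.generateFrom_le fun U hU =>
      (isOpen_of_isOpen_cePseudoMetricSpace hC he hU).measurableSet)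
  obtain ⟨D, hDc, hD⟩ := TopologicalSpace.exists_countable_dense (∀ s, Xs s)
  have hsep : @TopologicalSpace.SeparableSpace (∀ s, Xs s)
      P.toUniformSpace.toTopologicalSpace := by
    refine @TopologicalSpace.SeparableSpace.mk _ P.toUniformSpace.toTopologicalSpace
      ⟨D, hDc, fun x => ?_⟩
    refine (@mem_closure_iff _ P.toUniformSpace.toTopologicalSpace _ _).2 fun U hU hx => ?_
    exact mem_closure_iff.1 (hD x) U (isOpen_of_isOpen_cePseudoMetricSpace hC he hU) hx
  have hsec := @UniformSpace.secondCountable_of_separable _ P.toUniformSpace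
    (@EMetric.instIsCountablyGeneratedUniformity _ P.toPseudoEMetricSpace) hsep
  exact @sSup_integral_sub_eq_sInf_integral_dist _ P _ hopen hsec _ hbdd μ ν _ _
end
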